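/- arXiv:2511.03885 — 3 statements merged into one kernel-verified Lean document; each statement's English description precedes it below -/
import Mathlib

section
/- Weight Homogeneity: Let n ≥ 4, let S be an iterated sequence for Gr(3,n), and let I = (i_1 < i_2 < i_3) ∈ I_{3,n}. Then every exponent vector a ∈ ℕ^{3(n−3)} occurring in the support of the pullback φ_S^*(p̄_I) satisfies Ψ_S(a) = i_1 + i_2 + i_3 − 6. -/
/-!
Common framework: iterated sequences for Gr(3,n), the matrix `A_S`, pullbacks of
Plücker coordinates, the weighted reverse lexicographic order, lowest-term
valuations, Plücker relations, weighting matrices and initial ideals.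
-/

open MvPolynomial

noncomputable section

/-- Height of a positive root `(i,j) ↦ j - i`. -/
def Ht (β : ℕ × ℕ) : ℕ := β.2 - β.1

/-- `IsIter n S` : `S` is an iterated sequence for `Gr(3,n)`: it starts (as base of the
iteration) from a PBW sequence for `Gr(3,4)`, i.e. an ordering of `((1,4),(2,4),(3,4))`,
and for each `r = 5, …, n` a triple `((i₁,r),(i₂,r),(i₃,r))` with `i₁,i₂,i₃ ∈ [r-1]`
pairwise distinct is prepended. -/
inductive IsIter : ℕ → List (ℕ × ℕ) → Prop
  | base (L : List (ℕ × ℕ)) : L.Perm [(1,4),(2,4),(3,4)] → IsIter 4 L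
  | step (r : ℕ) (L : List (ℕ × ℕ)) (i₁ i₂ i₃ : ℕ) :
      4 ≤ r → IsIter r L →
      1 ≤ i₁ → i₁ ≤ r → 1 ≤ i₂ → i₂ ≤ r → 1 ≤ i₃ → i₃ ≤ r →
      i₁ ≠ i₂ → i₁ ≠ i₃ → i₂ ≠ i₃ →
      IsIter (r+1) ((i₁, r+1) :: (i₂, r+1) :: (i₃, r+1) :: L)

/-- `Sorted k n I` : `I ∈ I_{k,n}`, a strictly increasing `k`-tuple in `{1,…,n}`. -/
def Sorted (k n : ℕ) (I : Fin k → ℕ) : Prop :=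
  StrictMono I ∧ ∀ a, 1 ≤ I a ∧ I a ≤ n

/-- `ℕ`-indexed square "matrices" (1-based indexing, size given by a parameter `n`). -/
abbrev NMat := ℕ → ℕ → MvPolynomial (ℕ × ℕ) ℂ

/-- Product of two `n × n` matrices, 1-based indexing. -/
def matMul (n : ℕ) (A B : NMat) : NMat := fun i j => ∑ k ∈ Finset.Icc 1 n, A i k * B k j

/-- Identity matrix. -/
def idN : NMat := fun i j => if i = j then 1 else 0

/-- The factor `1 + x_β f_β`, where `f_β` is the matrix unit in entry `β = (i,j)`. -/
def factor (β : ℕ × ℕ) : NMat := fun i j =>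
  (if i = j then (1 : MvPolynomial (ℕ × ℕ) ℂ) else 0) +
    (if i = β.1 ∧ j = β.2 then (MvPolynomial.X β : MvPolynomial (ℕ × ℕ) ℂ) else 0)

/-- `A_S := (1 + x_{β_N} f_{β_N}) ⋯ (1 + x_{β_1} f_{β_1})` for `S = (β_1, …, β_N)`. -/
def ASmat (n : ℕ) : List (ℕ × ℕ) → NMat
  | [] => idN
  | β :: L => matMul n (ASmat n L) (factor β)

/-- `φ_S^*(p̄_I)` : the determinant of the `3×3` submatrix of `A_S` on rows `(1,2,3)`
and columns `I = (i₁,i₂,i₃)`. -/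
def phiStar (n : ℕ) (S : List (ℕ × ℕ)) (I : Fin 3 → ℕ) : MvPolynomial (ℕ × ℕ) ℂ :=
  Matrix.det (Matrix.of fun a b : Fin 3 => ASmat n S (a.val + 1) (I b))

/-- `Ψ_S(a) = Σ_l a_l Ht(β_l)`, the height-weighted function (written on exponents). -/
def Psi (d : (ℕ × ℕ) →₀ ℕ) : ℕ := d.sum fun β c => c * Ht β

/-- `a <_lex b` : lexicographic comparison of exponent vectors, the coordinates being
read in the order `β_1, …, β_N` of the sequence `S`. -/
def lexLT (S : List (ℕ × ℕ)) (a b : (ℕ × ℕ) →₀ ℕ) : Prop :=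
  ∃ k < S.length, (∀ m < k, a (S.getD m (0,0)) = b (S.getD m (0,0))) ∧
    a (S.getD k (0,0)) < b (S.getD k (0,0))

/-- `a ≤_lex b` on coordinates indexed by `S`. -/
def lexLE (S : List (ℕ × ℕ)) (a b : (ℕ × ℕ) →₀ ℕ) : Prop :=
  lexLT S a b ∨ ∀ k < S.length, a (S.getD k (0,0)) = b (S.getD k (0,0))

/-- `a ≺_{Ψ_S} b` : the strict `Ψ_S`-weighted reverse lexicographic order:
`Ψ_S(a) < Ψ_S(b)`, or `Ψ_S(a) = Ψ_S(b)` and `a >_lex b`. -/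
def psiLT (S : List (ℕ × ℕ)) (a b : (ℕ × ℕ) →₀ ℕ) : Prop :=
  Psi a < Psi b ∨ (Psi a = Psi b ∧ lexLT S b a)

/-- `a ⪯_{Ψ_S} b`. -/
def psiLE (S : List (ℕ × ℕ)) (a b : (ℕ × ℕ) →₀ ℕ) : Prop :=
  Psi a < Psi b ∨ (Psi a = Psi b ∧ lexLE S b a)

open scoped Classical in
/-- The `⪯_{Ψ_S}`-minimum of the support of a polynomial (defaulting to `0` if no
minimum exists). -/
def minSupp (S : List (ℕ × ℕ)) (f : MvPolynomial (ℕ × ℕ) ℂ) : (ℕ × ℕ) →₀ ℕ :=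
  if h : ∃ m ∈ f.support, ∀ m' ∈ f.support, psiLE S m m' then h.choose else 0

/-- The lowest-term valuation `v_S(p̄_I)` : the `⪯_{Ψ_S}`-minimum of the support of
`φ_S^*(p̄_I)`. -/
def valS (n : ℕ) (S : List (ℕ × ℕ)) (I : Fin 3 → ℕ) : (ℕ × ℕ) →₀ ℕ :=
  minSupp S (phiStar n S I)

/-- The index set `I_{3,n}` of Plücker variables. -/
abbrev MI (n : ℕ) := {v : Fin 3 → ℕ // Sorted 3 n v}

/-- The Plücker polynomial ring `ℂ[p_K : K ∈ I_{3,n}]`. -/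
abbrev PRing (n : ℕ) := MvPolynomial (MI n) ℂ

open scoped Classical in
/-- The Plücker variable `p_K`, defined to be `0` if `K` is not strictly increasing
(in particular `p_{I ∪ j} = 0` if `j ∈ I`). -/
def pvar (n : ℕ) (K : Fin 3 → ℕ) : PRing n :=
  if h : Sorted 3 n K then MvPolynomial.X (⟨K, h⟩ : MI n) else 0

/-- `I ∪ j` : the sorted triple obtained by adjoining `j` to the pair `I`. -/
def insert3 (I : Fin 2 → ℕ) (j : ℕ) : Fin 3 → ℕ :=
  fun a => (List.insertionSort (· ≤ ·) [I 0, I 1, j]).getD a 0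

/-- `J ∖ j` : the sorted triple obtained by removing `j` from the 4-tuple `J`. -/
def erase4 (J : Fin 4 → ℕ) (j : ℕ) : Fin 3 → ℕ :=
  fun a => (([J 0, J 1, J 2, J 3]).erase j).getD a 0

/-- The Plücker relation
`R_{I,J} = Σ_{j ∈ J} (−1)^{#{i∈I : i<j} + #{j'∈J : j<j'}} p_{I∪j} p_{J∖j}`. -/
def Rrel (n : ℕ) (I : Fin 2 → ℕ) (J : Fin 4 → ℕ) : PRing n :=
  ∑ a : Fin 4,
    (-1 : PRing n) ^ ((Finset.univ.filter fun b : Fin 2 => I b < J a).card +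
        (Finset.univ.filter fun b : Fin 4 => J a < J b).card) *
      (pvar n (insert3 I (J a)) * pvar n (erase4 J (J a)))

/-- The Plücker ideal `𝓘_{3,n}`, generated by all Plücker relations. -/
def PluckerIdeal (n : ℕ) : Ideal (PRing n) :=
  Ideal.span {f | ∃ I J, Sorted 2 n I ∧ Sorted 4 n J ∧ f = Rrel n I J}

/-- `M_S · m = Σ_K m_K v_S(p̄_K)` : the weighting matrix applied to an exponent. -/
def MSdot (n : ℕ) (S : List (ℕ × ℕ)) (m : MI n →₀ ℕ) : (ℕ × ℕ) →₀ ℕ :=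
  m.sum fun K c => c • valS n S K.val

open scoped Classical in
/-- The initial form `In_{M_S}(f)` : the sum of the terms of `f` whose `M_S`-weight is
`⪯_{Ψ_S}`-minimal. -/
def inM (n : ℕ) (S : List (ℕ × ℕ)) (f : PRing n) : PRing n :=
  ∑ m ∈ f.support.filter fun m => ∀ m' ∈ f.support, psiLE S (MSdot n S m) (MSdot n S m'),
    MvPolynomial.monomial m (f.coeff m)

/-- The initial ideal `In_{M_S}(𝓘_{3,n}) = ⟨In_{M_S}(g) : g ∈ 𝓘_{3,n}, g ≠ 0⟩`. -/
def InIdeal (n : ℕ) (S : List (ℕ × ℕ)) : Ideal (PRing n) :=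
  Ideal.span {g | ∃ f, f ∈ PluckerIdeal n ∧ f ≠ 0 ∧ g = inM n S f}

/-- Evaluation of the `ℤ`-linear functional with coefficients `c` on an exponent
vector (i.e. an element `e ∈ (ℤ^{3(n-3)})^*` given by its coefficients). -/
def evalF (c : ℕ × ℕ → ℤ) (d : (ℕ × ℕ) →₀ ℕ) : ℤ := d.sum fun β m => c β * (m : ℤ)

/-- `v_S(p̄_{I∪j}) + v_S(p̄_{J∖j})`, the `M_S`-weight of the term of `R_{I,J}`
corresponding to `j = J a`. -/
def wvec (n : ℕ) (S : List (ℕ × ℕ)) (I : Fin 2 → ℕ) (J : Fin 4 → ℕ) (a : Fin 4) :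
    (ℕ × ℕ) →₀ ℕ :=
  valS n S (insert3 I (J a)) + valS n S (erase4 J (J a))

/-- A `ℤ`-linear functional `e` (given by its coefficients `c`) *preserves inequalities*
with respect to `S` if for every nonzero Plücker relation `R_{I,J}` and all
`s₁, s₂ ∈ J ∖ I`, `v_S(p̄_{I∪s₁}) + v_S(p̄_{J∖s₁}) ≺_{Ψ_S} v_S(p̄_{I∪s₂}) + v_S(p̄_{J∖s₂})`
implies the corresponding strict inequality of the values of `e`. -/
def PreservesIneq (n : ℕ) (S : List (ℕ × ℕ)) (c : ℕ × ℕ → ℤ) : Prop :=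
  ∀ (I : Fin 2 → ℕ) (J : Fin 4 → ℕ), Sorted 2 n I → Sorted 4 n J → Rrel n I J ≠ 0 →
    ∀ a b : Fin 4, (∀ t : Fin 2, I t ≠ J a) → (∀ t : Fin 2, I t ≠ J b) →
      psiLT S (wvec n S I J a) (wvec n S I J b) →
      evalF c (wvec n S I J a) < evalF c (wvec n S I J b)

end

/-- The height of a positive root, as an integer weight on the variables. -/
def heightWeight (β : ℕ × ℕ) : ℤ := (Ht β : ℤ)

theorem weight_heightWeight (d : (ℕ × ℕ) →₀ ℕ) :
    Finsupp.weight heightWeight d = (Psi d : ℤ) := by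
  simp [Finsupp.weight_apply, Psi, Finsupp.sum, heightWeight]

theorem IsIter.fst_le_snd {n : ℕ} {S : List (ℕ × ℕ)} (hS : IsIter n S) :
    ∀ β ∈ S, β.1 ≤ β.2 := by
  induction hS with
  | base L hL =>
    intro β hβ
    have h := hL.mem_iff.mp hβ
    simp only [List.mem_cons, List.not_mem_nil, or_false] at h
    rcases h with rfl | rfl | rfl <;> norm_num
  | step r L i₁ i₂ i₃ _ _ _ h₁ _ h₂ _ h₃ _ _ _ ih =>
    intro β hβ
    simp only [List.mem_cons] at hβ
    rcases hβ with rfl | rfl | rfl | h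
    · exact Nat.le_succ_of_le h₁
    · exact Nat.le_succ_of_le h₂
    · exact Nat.le_succ_of_le h₃
    · exact ih β h

theorem isWeightedHomogeneous_idN (i j : ℕ) :
    IsWeightedHomogeneous heightWeight (idN i j) ((j : ℤ) - i) := by
  unfold idN
  split_ifs with h
  · subst h
    simpa using isWeightedHomogeneous_one ℂ heightWeight
  · exact isWeightedHomogeneous_zero ℂ heightWeight _

theorem isWeightedHomogeneous_factor {β : ℕ × ℕ} (hβ : β.1 ≤ β.2) (i j : ℕ) :
    IsWeightedHomogeneous heightWeight (factor β i j) ((j : ℤ) - i) := by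
  refine (isWeightedHomogeneous_idN i j).add ?_
  split_ifs with h
  · obtain ⟨rfl, rfl⟩ := h
    have hw : heightWeight β = (β.2 : ℤ) - β.1 := by simp [heightWeight, Ht, hβ]
    exact hw ▸ isWeightedHomogeneous_X ℂ heightWeight β
  · exact isWeightedHomogeneous_zero ℂ heightWeight _

/-- The entry `(i, j)` of `A_S` is homogeneous of weight `j - i`. -/
theorem isWeightedHomogeneous_ASmat (n : ℕ) {S : List (ℕ × ℕ)} (hS : ∀ β ∈ S, β.1 ≤ β.2)
    (i j : ℕ) : IsWeightedHomogeneous heightWeight (ASmat n S i j) ((j : ℤ) - i) := by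
  induction S generalizing i j with
  | nil => exact isWeightedHomogeneous_idN i j
  | cons β L ih =>
    rw [List.forall_mem_cons] at hS
    refine IsWeightedHomogeneous.sum _ _ _ fun k _ => ?_
    convert (ih hS.2 i k).mul (isWeightedHomogeneous_factor hS.1 k j) using 1
    ring

theorem isWeightedHomogeneous_phiStar (n : ℕ) {S : List (ℕ × ℕ)} (hS : ∀ β ∈ S, β.1 ≤ β.2)
    (I : Fin 3 → ℕ) :
    IsWeightedHomogeneous heightWeight (phiStar n S I) ((I 0 : ℤ) + I 1 + I 2 - 6) := by
  unfold phiStar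
  rw [Matrix.det_apply]
  simp only [Matrix.of_apply]
  refine IsWeightedHomogeneous.sum _ _ _ fun σ _ => ?_
  refine (weightedHomogeneousSubmodule ℂ heightWeight _).smul_of_tower_mem (Equiv.Perm.sign σ) ?_
  rw [mem_weightedHomogeneousSubmodule]
  convert IsWeightedHomogeneous.prod Finset.univ _
    (fun b => (I b : ℤ) - (((σ b).val + 1 : ℕ) : ℤ))
    (fun b _ => isWeightedHomogeneous_ASmat n hS ((σ b).val + 1) (I b)) using 1
  rw [Finset.sum_sub_distrib, Equiv.sum_comp σ fun b => (((b.val + 1 : ℕ)) : ℤ)]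
  simp [Fin.sum_univ_three]

/-- **Weight Homogeneity** : for an iterated sequence `S` for `Gr(3,n)` and
`I = (i₁ < i₂ < i₃) ∈ I_{3,n}`, every exponent vector `d` in the support of
`φ_S^*(p̄_I)` satisfies `Ψ_S(d) = i₁ + i₂ + i₃ - 6`. -/
theorem weight_homogeneity (n : ℕ) (hn : 4 ≤ n) (S : List (ℕ × ℕ)) (hS : IsIter n S)
    (I : Fin 3 → ℕ) (hI : Sorted 3 n I) :
    ∀ d ∈ (phiStar n S I).support, Psi d + 6 = I 0 + I 1 + I 2 := by
  intro d hd
  have h := isWeightedHomogeneous_phiStar n hS.fst_le_snd I (mem_support_iff.mp hd)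
  rw [weight_heightWeight] at h
  omega
end

section
/- Let n ≥ 4, let S be an iterated sequence for Gr(3,n), and let I ∈ I_{3,n}. Then the lowest-term valuation satisfies v_S(p̄_I) = max_{lex} { m ∈ ℕ^{3(n−3)} : x^m occurs in the support of φ_S^*(p̄_I) }; that is, the ⪯_{Ψ_S}-minimum of the support equals its lexicographic maximum. -/
/-!
Common framework: iterated sequences for Gr(3,n), the matrix `A_S`, pullbacks of
Plücker coordinates, the weighted reverse lexicographic order, lowest-term
valuations, Plücker relations, weighting matrices and initial ideals.
-/

open MvPolynomial

/-- The size-free form of `ASmat`: the factor of `β` adds `x_β` times column `β.1` to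
column `β.2`. -/
noncomputable def colMat : List (ℕ × ℕ) → ℕ → ℕ → MvPolynomial (ℕ × ℕ) ℂ
  | [] => idN
  | β :: L => fun i j => colMat L i j + if j = β.2 then colMat L i β.1 * X β else 0

lemma ASmat_eq_colMat {n : ℕ} {L : List (ℕ × ℕ)} (hL : ∀ β ∈ L, 1 ≤ β.1 ∧ β.1 ≤ n)
    (i : ℕ) {j : ℕ} (hj : 1 ≤ j ∧ j ≤ n) : ASmat n L i j = colMat L i j := by
  induction L generalizing j with
  | nil => rfl
  | cons β L ih =>
    have ih' := fun {j : ℕ} => @ih (fun γ hγ => hL γ (List.mem_cons_of_mem _ hγ)) j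
    have hβ := hL β List.mem_cons_self
    simp only [ASmat, matMul, factor, colMat, mul_add, Finset.sum_add_distrib]
    congr 1
    · simp [hj, ih' hj]
    · by_cases h : j = β.2
      · simp [h, hβ, ih' hβ]
      · simp [h]

lemma colMat_of_forall_ne {L : List (ℕ × ℕ)} {j : ℕ} (hL : ∀ β ∈ L, β.2 ≠ j) (i : ℕ) :
    colMat L i j = idN i j := by
  induction L with
  | nil => rfl
  | cons β L ih =>
    simp only [List.mem_cons, forall_eq_or_imp] at hL
    simp [colMat, ih hL.2, hL.1.symm]

/-- The weights with respect to which `Psi` is the weighted degree. -/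
def htWeight (β : ℕ × ℕ) : ℤ := Ht β

lemma weight_htWeight (d : (ℕ × ℕ) →₀ ℕ) : Finsupp.weight htWeight d = Psi d := by
  simp [Finsupp.weight_apply, Psi, htWeight, Finsupp.sum]

lemma isWeightedHomogeneous_colMat {L : List (ℕ × ℕ)} (hL : ∀ β ∈ L, β.1 < β.2) (i j : ℕ) :
    IsWeightedHomogeneous htWeight (colMat L i j) ((j : ℤ) - i) := by
  induction L generalizing j with
  | nil =>
    by_cases h : i = j
    · simpa [colMat, idN, h] using isWeightedHomogeneous_one ℂ htWeight
    · simpa [colMat, idN, h] using isWeightedHomogeneous_zero ℂ htWeight _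
  | cons β L ih =>
    have hβ := hL β List.mem_cons_self
    replace ih := ih fun γ hγ => hL γ (List.mem_cons_of_mem _ hγ)
    refine (ih j).add ?_
    split_ifs with h
    · have hw : ((j : ℤ) - i) = ((β.1 : ℤ) - i) + htWeight β := by
        simp only [htWeight, Ht, h]
        omega
      rw [hw]
      exact (ih β.1).mul (isWeightedHomogeneous_X ℂ htWeight β)
    · exact isWeightedHomogeneous_zero ℂ htWeight _

/-- The maximal minor of `colMat L` on rows `1, 2, 3` and columns `I`. -/
noncomputable def colMinor (L : List (ℕ × ℕ)) (I : Fin 3 → ℕ) : MvPolynomial (ℕ × ℕ) ℂ :=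
  Matrix.det (Matrix.of fun a b : Fin 3 => colMat L (a.val + 1) (I b))

lemma isWeightedHomogeneous_colMinor {L : List (ℕ × ℕ)} (hL : ∀ β ∈ L, β.1 < β.2)
    (I : Fin 3 → ℕ) :
    IsWeightedHomogeneous htWeight (colMinor L I) (∑ b, ((I b : ℤ) - (b.val + 1))) := by
  rw [colMinor, Matrix.det_apply]
  refine IsWeightedHomogeneous.sum _ _ _ fun σ _ => ?_
  have hprod := IsWeightedHomogeneous.prod Finset.univ
    (fun b : Fin 3 => colMat L ((σ b).val + 1) (I b)) _
    fun b _ => isWeightedHomogeneous_colMat hL ((σ b).val + 1) (I b)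
  have hdeg : ∑ b : Fin 3, ((I b : ℤ) - (((σ b).val + 1 : ℕ) : ℤ)) =
      ∑ b : Fin 3, ((I b : ℤ) - (b.val + 1)) := by
    simp only [Finset.sum_sub_distrib, Nat.cast_add, Nat.cast_one]
    rw [Equiv.sum_comp σ fun b : Fin 3 => ((b.val : ℤ) + 1)]
  rw [hdeg] at hprod
  rw [Units.smul_def]
  exact zsmul_mem (show _ ∈ weightedHomogeneousSubmodule ℂ htWeight _ from hprod) _

lemma eval_colMat_congr {L : List (ℕ × ℕ)} {x y : ℕ × ℕ → ℂ} (hxy : ∀ β ∈ L, x β = y β)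
    (i j : ℕ) : eval x (colMat L i j) = eval y (colMat L i j) := by
  induction L generalizing j with
  | nil => by_cases h : i = j <;> simp [colMat, idN, h]
  | cons β L ih =>
    simp only [List.mem_cons, forall_eq_or_imp] at hxy
    by_cases h : j = β.2 <;> simp [colMat, h, ih hxy.2, hxy.1]

lemma eval_colMinor (L : List (ℕ × ℕ)) (I : Fin 3 → ℕ) (x : ℕ × ℕ → ℂ) :
    eval x (colMinor L I) =
      Matrix.det (Matrix.of fun a b : Fin 3 => eval x (colMat L (a.val + 1) (I b))) := by
  rw [colMinor, RingHom.map_det]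
  rfl

/-- Every pair in `L` is a positive root `(i, j)` with `j ≤ r`, and no minor on distinct
columns in `{1, …, r}` vanishes identically. -/
structure NonvanishingMinors (r : ℕ) (L : List (ℕ × ℕ)) : Prop where
  mem : ∀ β ∈ L, 1 ≤ β.1 ∧ β.1 < β.2 ∧ β.2 ≤ r
  minor : ∀ I : Fin 3 → ℕ, Function.Injective I → (∀ a, 1 ≤ I a ∧ I a ≤ r) →
    ∃ x : ℕ × ℕ → ℂ, eval x (colMinor L I) ≠ 0

lemma NonvanishingMinors.nil : NonvanishingMinors 3 [] where
  mem := by simp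
  minor I hinj hI := by
    refine ⟨0, ?_⟩
    have h01 : I 0 ≠ I 1 := fun h => absurd (hinj h) (by decide)
    have h02 : I 0 ≠ I 2 := fun h => absurd (hinj h) (by decide)
    have h12 : I 1 ≠ I 2 := fun h => absurd (hinj h) (by decide)
    obtain ⟨a0, b0⟩ := hI 0
    obtain ⟨a1, b1⟩ := hI 1
    obtain ⟨a2, b2⟩ := hI 2
    rw [eval_colMinor, Matrix.det_fin_three]
    simp only [colMat, idN, Matrix.of_apply]
    generalize I 0 = p at *
    generalize I 1 = q at *
    generalize I 2 = s at *
    interval_cases p <;> interval_cases q <;> interval_cases s <;> simp at h01 h02 h12 ⊢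

lemma NonvanishingMinors.step {r : ℕ} {L : List (ℕ × ℕ)} (hL : NonvanishingMinors r L)
    (hr : 3 ≤ r) {i : Fin 3 → ℕ} (hi : ∀ k, 1 ≤ i k ∧ i k ≤ r) (hinj : Function.Injective i) :
    NonvanishingMinors (r + 1) ((i 0, r + 1) :: (i 1, r + 1) :: (i 2, r + 1) :: L) where
  mem := by
    have h0 := hi 0
    have h1 := hi 1
    have h2 := hi 2
    simp only [List.mem_cons]
    rintro β (rfl | rfl | rfl | h)
    · simp; omega
    · simp; omega
    · simp; omega
    · have := hL.mem β h
      omega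
  minor I hIinj hI := by
    have hne : ∀ k, i k ≠ r + 1 := fun k => by have := hi k; omega
    have hcol : ∀ (x : ℕ × ℕ → ℂ) (a b : ℕ), b ≠ r + 1 →
        eval x (colMat ((i 0, r + 1) :: (i 1, r + 1) :: (i 2, r + 1) :: L) a b) =
          eval x (colMat L a b) := by
      intro x a b hb
      simp [colMat, hb]
    by_cases hc : ∃ c, I c = r + 1
    · obtain ⟨c, hc⟩ := hc
      obtain ⟨k, hk⟩ : ∃ k, ∀ a, a ≠ c → I a ≠ i k := by
        by_contra! h
        choose f hfc hf using h
        have hfinj : Function.Injective f := fun k l hkl =>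
          hinj (by rw [← hf k, ← hf l, hkl])
        obtain ⟨k, hk⟩ := Finite.surjective_of_injective hfinj c
        exact hfc k hk
      have hother : ∀ a, a ≠ c → I a ≠ r + 1 := fun a ha h => ha (hIinj (h.trans hc.symm))
      obtain ⟨x, hx⟩ := hL.minor (Function.update I c (i k))
        (by
          intro a b hab
          by_cases ha : a = c <;> by_cases hb : b = c
          · rw [ha, hb]
          · subst ha
            simp [hb] at hab
            exact absurd hab.symm (hk b hb)
          · subst hb
            simp [ha] at hab
            exact absurd hab (hk a ha)
          · simp [ha, hb] at hab
            exact hIinj hab)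
        (by
          intro a
          by_cases ha : a = c
          · subst ha
            simpa using hi k
          · have h1 := hI a
            have h2 := hother a ha
            simp only [Function.update_of_ne ha]
            omega)
      refine ⟨fun β => if β.2 = r + 1 then (if β.1 = i k then 1 else 0) else x β, ?_⟩
      set y : ℕ × ℕ → ℂ :=
        fun β => if β.2 = r + 1 then (if β.1 = i k then 1 else 0) else x β with hy
      have hyx : ∀ β ∈ L, y β = x β := fun β hβ => by
        have := hL.mem β hβ
        exact if_neg (by omega)
      have hzero : ∀ a : Fin 3, colMat L (a.val + 1) (r + 1) = 0 := fun a => by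
        rw [colMat_of_forall_ne fun β hβ => by have := hL.mem β hβ; omega]
        exact if_neg (by omega)
      convert hx using 1
      rw [eval_colMinor, eval_colMinor]
      congr 1
      ext a b
      simp only [Matrix.of_apply]
      by_cases hb : b = c
      · subst hb
        have hyk : ∀ l, y (i l, r + 1) = if l = k then 1 else 0 := fun l => by
          simp [hy, hinj.eq_iff]
        have hsum : eval y (colMat ((i 0, r + 1) :: (i 1, r + 1) :: (i 2, r + 1) :: L)
            (a.val + 1) (r + 1)) =
            ∑ l, eval y (colMat L (a.val + 1) (i l)) * y (i l, r + 1) := by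
          simp [colMat, hne, hzero, Fin.sum_univ_three]
          ring
        rw [hc, hsum, Function.update_self]
        simp only [hyk, mul_ite, mul_one, mul_zero, Finset.sum_ite_eq', Finset.mem_univ, if_true]
        exact eval_colMat_congr hyx _ _
      · rw [Function.update_of_ne hb, hcol _ _ _ (hother b hb)]
        exact eval_colMat_congr hyx _ _
    · push Not at hc
      obtain ⟨x, hx⟩ := hL.minor I hIinj fun a => by
        have h1 := hI a
        have h2 := hc a
        omega
      refine ⟨x, ?_⟩
      rw [eval_colMinor] at hx ⊢
      simpa only [hcol x _ _ (hc _)] using hx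

lemma injective_vec_three {a b c : ℕ} (hab : a ≠ b) (hac : a ≠ c) (hbc : b ≠ c) :
    Function.Injective ![a, b, c] := by
  intro k l h
  fin_cases k <;> fin_cases l <;> simp_all

lemma IsIter.nonvanishingMinors {n : ℕ} {S : List (ℕ × ℕ)} (hS : IsIter n S) :
    NonvanishingMinors n S := by
  induction hS with
  | base L hL =>
    obtain ⟨β, γ, δ, rfl⟩ := List.length_eq_three.mp hL.length_eq
    have hnd : [β, γ, δ].Nodup := hL.nodup_iff.mpr (by decide)
    have hmem : ∀ ε ∈ [β, γ, δ], (1 ≤ ε.1 ∧ ε.1 ≤ 3) ∧ ε.2 = 4 := fun ε hε => by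
      have := hL.mem_iff.mp hε
      simp only [List.mem_cons, List.not_mem_nil, or_false] at this
      rcases this with rfl | rfl | rfl <;> simp
    obtain ⟨a, a'⟩ := β
    obtain ⟨b, b'⟩ := γ
    obtain ⟨c, c'⟩ := δ
    simp only [List.mem_cons, List.not_mem_nil, or_false, forall_eq_or_imp, forall_eq] at hmem
    obtain ⟨⟨ha, rfl⟩, ⟨hb, rfl⟩, ⟨hc, rfl⟩⟩ := hmem
    simp at hnd
    exact NonvanishingMinors.nil.step le_rfl (i := ![a, b, c])
      (fun k => by fin_cases k <;> assumption)
      (injective_vec_three hnd.1.1 hnd.1.2 hnd.2)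
  | step r L i₁ i₂ i₃ hr _ h1 h1' h2 h2' h3 h3' h12 h13 h23 ih =>
    exact ih.step (by omega) (i := ![i₁, i₂, i₃])
      (fun k => by fin_cases k <;> constructor <;> assumption)
      (injective_vec_three h12 h13 h23)

/-- The exponent vector with coordinates read in the order of `S`, in the lexicographic order. -/
def lexKey (S : List (ℕ × ℕ)) (d : (ℕ × ℕ) →₀ ℕ) : Lex (Fin S.length → ℕ) :=
  toLex fun k => d (S.getD k (0, 0))

lemma lexLE_of_lexKey_le {S : List (ℕ × ℕ)} {a b : (ℕ × ℕ) →₀ ℕ}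
    (h : lexKey S a ≤ lexKey S b) : lexLE S a b := by
  rcases h.lt_or_eq with h | h
  · obtain ⟨k, hk, hlt⟩ := h
    exact Or.inl ⟨k, k.isLt, fun m hm => hk ⟨m, hm.trans k.isLt⟩ hm, hlt⟩
  · exact Or.inr fun k hk => congrFun (toLex.injective h) ⟨k, hk⟩

/-- The lowest-term valuation `v_S(p̄_I)` (the `⪯_{Ψ_S}`-minimum of the support of
`φ_S^*(p̄_I)`) equals the lexicographic maximum of that support. -/
theorem valuation_eq_lex_max (n : ℕ) (hn : 4 ≤ n) (S : List (ℕ × ℕ)) (hS : IsIter n S)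
    (I : Fin 3 → ℕ) (hI : Sorted 3 n I) :
    valS n S I ∈ (phiStar n S I).support ∧
    (∀ d ∈ (phiStar n S I).support, psiLE S (valS n S I) d) ∧
    (∀ d ∈ (phiStar n S I).support, lexLE S d (valS n S I)) := by
  have hM := hS.nonvanishingMinors
  have hphi : phiStar n S I = colMinor S I := by
    simp only [phiStar, colMinor]
    congr 2
    ext1 a
    ext1 b
    exact ASmat_eq_colMat (fun β hβ => by have := hM.mem β hβ; omega) _ (hI.2 b)
  obtain ⟨x, hx⟩ := hM.minor I hI.1.injective hI.2
  have hne : (phiStar n S I).support.Nonempty := by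
    rw [Finset.nonempty_iff_ne_empty, Ne, support_eq_empty, hphi]
    intro h
    simp [h] at hx
  have hPsi : ∀ d ∈ (phiStar n S I).support, ∀ e ∈ (phiStar n S I).support, Psi d = Psi e := by
    have hhom := isWeightedHomogeneous_colMinor (fun β hβ => (hM.mem β hβ).2.1) I
    rw [hphi]
    intro d hd e he
    have h := (hhom (mem_support_iff.mp hd)).trans (hhom (mem_support_iff.mp he)).symm
    rw [weight_htWeight, weight_htWeight] at h
    exact_mod_cast h
  obtain ⟨m, hm, hmax⟩ := Finset.exists_max_image _ (lexKey S) hne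
  have hex : ∃ m ∈ (phiStar n S I).support, ∀ d ∈ (phiStar n S I).support, psiLE S m d :=
    ⟨m, hm, fun d hd => Or.inr ⟨hPsi m hm d hd, lexLE_of_lexKey_le (hmax d hd)⟩⟩
  have hval : valS n S I = hex.choose := dif_pos hex
  obtain ⟨hmem, hmin⟩ := hex.choose_spec
  rw [← hval] at hmem hmin
  refine ⟨hmem, hmin, fun d hd => ?_⟩
  rcases hmin d hd with h | h
  · exact absurd (hPsi _ hmem d hd) h.ne
  · exact h.2
end

section
/- Let n ≥ 4, let S be an iterated sequence for Gr(3,n), I = (i_1,i_2) ∈ I_{2,n}, J = (j_1,j_2,j_3,j_4) ∈ I_{4,n} with R_{I,J} ≠ 0. Then for every j ∈ J with j ∉ I, Ψ_S( v_S(p̄_{I∪j}) + v_S(p̄_{J∖j}) ) = i_1 + i_2 + j_1 + j_2 + j_3 + j_4 − 12. -/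
/-!
Common framework: iterated sequences for Gr(3,n), the matrix `A_S`, pullbacks of
Plücker coordinates, the weighted reverse lexicographic order, lowest-term
valuations, Plücker relations, weighting matrices and initial ideals.
-/

open MvPolynomial

lemma ASmat_cons_apply {m : ℕ} (β : ℕ × ℕ) (L : List (ℕ × ℕ)) (i : ℕ) {j : ℕ}
    (hj : 1 ≤ j ∧ j ≤ m) (hβ : 1 ≤ β.1 ∧ β.1 ≤ m) :
    ASmat m (β :: L) i j =
      ASmat m L i j + if j = β.2 then ASmat m L i β.1 * X β else 0 := by
  simp only [ASmat, matMul, factor, mul_add, Finset.sum_add_distrib, mul_ite, mul_one, mul_zero]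
  congr 1
  · rw [Finset.sum_ite_eq' _ j, if_pos (Finset.mem_Icc.2 hj)]
  · by_cases h : j = β.2
    · simp only [h, and_true, if_true]
      rw [Finset.sum_ite_eq' _ β.1, if_pos (Finset.mem_Icc.2 hβ)]
    · simp [h]

/-- The sequence `L` consists of positive roots of type `A_{r-1}`. -/
def PosRoots (r : ℕ) (L : List (ℕ × ℕ)) : Prop :=
  ∀ β ∈ L, 1 ≤ β.1 ∧ β.1 < β.2 ∧ β.2 ≤ r

lemma PosRoots.mono {r s : ℕ} {L : List (ℕ × ℕ)} (h : PosRoots r L) (hrs : r ≤ s) :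
    PosRoots s L :=
  fun β hβ => ⟨(h β hβ).1, (h β hβ).2.1, (h β hβ).2.2.trans hrs⟩

/-- Every entry of `A_S` is homogeneous for the height weight. -/
lemma ASmat_isWeightedHomogeneous {m : ℕ} {L : List (ℕ × ℕ)} (hL : PosRoots m L)
    (i : ℕ) {j : ℕ} (hj : 1 ≤ j ∧ j ≤ m) :
    IsWeightedHomogeneous (fun β => (Ht β : ℤ)) (ASmat m L i j) ((j : ℤ) - i) := by
  induction L generalizing j with
  | nil =>
    simp only [ASmat, idN]
    split_ifs with h
    · subst h
      simpa using isWeightedHomogeneous_one ℂ (fun β => (Ht β : ℤ))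
    · exact isWeightedHomogeneous_zero ℂ _ _
  | cons β L ih =>
    have hβ := hL β (by simp)
    have hL' : PosRoots m L := fun γ hγ => hL γ (by simp [hγ])
    rw [ASmat_cons_apply β L i hj ⟨hβ.1, by omega⟩]
    refine (ih hL' hj).add ?_
    split_ifs with h
    · have hmul := (ih hL' (j := β.1) ⟨hβ.1, by omega⟩).mul
        (isWeightedHomogeneous_X ℂ (fun β => (Ht β : ℤ)) β)
      have hdeg : ((β.1 : ℤ) - i) + (Ht β : ℤ) = (j : ℤ) - i := by
        rw [Ht, Nat.cast_sub hβ.2.1.le, h]; ring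
      rwa [hdeg] at hmul
    · exact isWeightedHomogeneous_zero ℂ _ _

lemma phiStar_isWeightedHomogeneous {m : ℕ} {L : List (ℕ × ℕ)} (hL : PosRoots m L)
    {I : Fin 3 → ℕ} (hI : ∀ b, 1 ≤ I b ∧ I b ≤ m) :
    IsWeightedHomogeneous (fun β => (Ht β : ℤ)) (phiStar m L I)
      ((I 0 + I 1 + I 2 : ℤ) - 6) := by
  rw [phiStar, Matrix.det_apply]
  refine IsWeightedHomogeneous.sum _ _ _ fun σ _ => ?_
  have hprod := IsWeightedHomogeneous.prod Finset.univ
    (fun b : Fin 3 => ASmat m L ((σ b).val + 1) (I b)) _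
    (fun b _ => ASmat_isWeightedHomogeneous hL ((σ b).val + 1) (hI b))
  have hdeg : ∑ b : Fin 3, ((I b : ℤ) - (((σ b).val + 1 : ℕ) : ℤ)) =
      (I 0 + I 1 + I 2 : ℤ) - 6 := by
    rw [Finset.sum_sub_distrib, Equiv.sum_comp σ (fun b : Fin 3 => ((b.val + 1 : ℕ) : ℤ))]
    simp [Fin.sum_univ_three]
  rw [hdeg] at hprod
  simp only [Matrix.of_apply]
  rw [Units.smul_def]
  exact zsmul_mem (K := weightedHomogeneousSubmodule ℂ (fun β => (Ht β : ℤ)) _) hprod _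

lemma psi_of_mem_support {m : ℕ} {L : List (ℕ × ℕ)} (hL : PosRoots m L)
    {I : Fin 3 → ℕ} (hI : ∀ b, 1 ≤ I b ∧ I b ≤ m) {d : (ℕ × ℕ) →₀ ℕ}
    (hd : d ∈ (phiStar m L I).support) : Psi d + 6 = I 0 + I 1 + I 2 := by
  have h := phiStar_isWeightedHomogeneous hL hI (mem_support_iff.1 hd)
  have hpsi : Finsupp.weight (fun β => (Ht β : ℤ)) d = (Psi d : ℤ) := by
    rw [Finsupp.weight_apply, Psi, Finsupp.sum, Finsupp.sum]
    simp
  rw [hpsi] at h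
  omega

/-- The coordinates of an exponent vector, as a linearly ordered key for `≺_{Ψ_S}`. -/
def psiKey (S : List (ℕ × ℕ)) (d : (ℕ × ℕ) →₀ ℕ) :
    ℕ ×ₗ (Lex (Fin S.length → ℕ))ᵒᵈ :=
  toLex (Psi d, OrderDual.toDual (toLex fun k : Fin S.length => d (S.getD k (0, 0))))

lemma psiLE_of_psiKey_le {S : List (ℕ × ℕ)} {a b : (ℕ × ℕ) →₀ ℕ}
    (h : psiKey S a ≤ psiKey S b) : psiLE S a b := by
  rw [psiKey, psiKey, Prod.Lex.toLex_le_toLex] at h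
  refine h.imp id fun ⟨h₁, h₂⟩ => ⟨h₁, ?_⟩
  rcases (OrderDual.toDual_le_toDual.1 h₂).lt_or_eq with hlt | heq
  · obtain ⟨k, hk, hlt⟩ := hlt
    exact Or.inl ⟨k, k.2, fun i hi => hk ⟨i, hi.trans k.2⟩ hi, hlt⟩
  · exact Or.inr fun k hk => congrFun (toLex.injective heq) ⟨k, hk⟩

lemma minSupp_mem_support (S : List (ℕ × ℕ)) {f : MvPolynomial (ℕ × ℕ) ℂ} (hf : f ≠ 0) :
    minSupp S f ∈ f.support := by
  obtain ⟨d, hd, hmin⟩ := f.support.exists_min_image (psiKey S) (support_nonempty.2 hf)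
  have h : ∃ m ∈ f.support, ∀ m' ∈ f.support, psiLE S m m' :=
    ⟨d, hd, fun m' hm' => psiLE_of_psiKey_le (hmin m' hm')⟩
  rw [minSupp, dif_pos h]
  exact h.choose_spec.1

lemma eval_ASmat_congr {m : ℕ} {L : List (ℕ × ℕ)} (hL : PosRoots m L)
    {v w : ℕ × ℕ → ℂ} (hvw : ∀ β ∈ L, v β = w β) (i : ℕ) {j : ℕ} (hj : 1 ≤ j ∧ j ≤ m) :
    eval v (ASmat m L i j) = eval w (ASmat m L i j) := by
  induction L generalizing j with
  | nil => simp only [ASmat, idN]; split_ifs <;> simp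
  | cons β L ih =>
    have hβ := hL β (by simp)
    have hL' : PosRoots m L := fun γ hγ => hL γ (by simp [hγ])
    have hvw' : ∀ γ ∈ L, v γ = w γ := fun γ hγ => hvw γ (by simp [hγ])
    rw [ASmat_cons_apply β L i hj ⟨hβ.1, by omega⟩, map_add, map_add, ih hL' hvw' hj]
    split_ifs
    · rw [map_mul, map_mul, ih hL' hvw' ⟨hβ.1, by omega⟩, eval_X, eval_X, hvw β (by simp)]
    · simp

/-- Columns beyond the range of the roots are those of the identity matrix. -/
lemma ASmat_of_lt {r m : ℕ} {L : List (ℕ × ℕ)} (hL : PosRoots r L) (i : ℕ) {j : ℕ}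
    (hrj : r < j) (hjm : j ≤ m) : ASmat m L i j = idN i j := by
  induction L with
  | nil => rfl
  | cons β L ih =>
    have hβ := hL β (by simp)
    rw [ASmat_cons_apply β L i ⟨by omega, hjm⟩ ⟨hβ.1, by omega⟩, if_neg (by omega), add_zero]
    exact ih fun γ hγ => hL γ (by simp [hγ])

/-- In every ambient size `m ≥ r`, all maximal minors of the first three rows with distinct
columns in `{1,…,r}` can be made nonzero by specializing the variables. -/
def MinorsNonvanishing (r : ℕ) (L : List (ℕ × ℕ)) : Prop :=
  ∀ m, r ≤ m → ∀ I : Fin 3 → ℕ, Function.Injective I → (∀ b, 1 ≤ I b ∧ I b ≤ r) →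
    ∃ v : ℕ × ℕ → ℂ,
      (Matrix.of fun a b : Fin 3 => eval v (ASmat m L (a.val + 1) (I b))).det ≠ 0

lemma minorsNonvanishing_nil : MinorsNonvanishing 3 [] := by
  intro m _ I hI hb
  refine ⟨0, ?_⟩
  let σ : Fin 3 → Fin 3 := fun b => ⟨I b - 1, by have := hb b; omega⟩
  have hσ : Function.Injective σ := fun a b hab => hI (by
    have := hb a
    have := hb b
    have := congrArg Fin.val hab
    simp only [σ] at this
    omega)
  have hM : (Matrix.of fun a b : Fin 3 => eval (0 : ℕ × ℕ → ℂ) (ASmat m [] (a.val + 1) (I b))) =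
      (1 : Matrix (Fin 3) (Fin 3) ℂ).submatrix id
        (Equiv.ofBijective σ (Finite.injective_iff_bijective.1 hσ)) := by
    ext a b
    have := hb b
    have hiff : a.val + 1 = I b ↔ a = σ b := by
      simp only [σ, Fin.ext_iff]; omega
    simp only [ASmat, idN, Matrix.of_apply, Matrix.submatrix_apply, Matrix.one_apply, id,
      Equiv.ofBijective_apply, hiff]
    split_ifs <;> simp
  rw [hM, Matrix.det_permute']
  simp

lemma ASmat_triple_of_ne {r m : ℕ} {L : List (ℕ × ℕ)} {i₁ i₂ i₃ : ℕ} (hrm : r + 1 ≤ m)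
    (h₁ : 1 ≤ i₁ ∧ i₁ ≤ r) (h₂ : 1 ≤ i₂ ∧ i₂ ≤ r) (h₃ : 1 ≤ i₃ ∧ i₃ ≤ r) (i : ℕ) {j : ℕ}
    (hj : 1 ≤ j ∧ j ≤ r) :
    ASmat m ((i₁, r + 1) :: (i₂, r + 1) :: (i₃, r + 1) :: L) i j = ASmat m L i j := by
  have hj' : 1 ≤ j ∧ j ≤ m := ⟨hj.1, by omega⟩
  have hne : j ≠ r + 1 := by omega
  rw [ASmat_cons_apply _ _ _ hj' ⟨h₁.1, by dsimp; omega⟩,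
    ASmat_cons_apply _ _ _ hj' ⟨h₂.1, by dsimp; omega⟩,
    ASmat_cons_apply _ _ _ hj' ⟨h₃.1, by dsimp; omega⟩]
  simp [hne]

lemma ASmat_triple_last {r m : ℕ} {L : List (ℕ × ℕ)} (hL : PosRoots r L) {i₁ i₂ i₃ : ℕ}
    (hrm : r + 1 ≤ m) (h₁ : 1 ≤ i₁ ∧ i₁ ≤ r) (h₂ : 1 ≤ i₂ ∧ i₂ ≤ r) (h₃ : 1 ≤ i₃ ∧ i₃ ≤ r)
    {i : ℕ} (hi : i ≤ r) :
    ASmat m ((i₁, r + 1) :: (i₂, r + 1) :: (i₃, r + 1) :: L) i (r + 1) =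
      ASmat m L i i₃ * X (i₃, r + 1) + ASmat m L i i₂ * X (i₂, r + 1) +
        ASmat m L i i₁ * X (i₁, r + 1) := by
  have hid : idN i (r + 1) = 0 := if_neg (by omega)
  have hj : 1 ≤ r + 1 ∧ r + 1 ≤ m := ⟨by omega, hrm⟩
  have hcol : ∀ (β : ℕ × ℕ) (M : List (ℕ × ℕ)) (k : ℕ), β.2 = r + 1 → 1 ≤ β.1 ∧ β.1 ≤ r →
      1 ≤ k ∧ k ≤ r → ASmat m (β :: M) i k = ASmat m M i k := by
    intro β M k hβ₂ hβ₁ hk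
    rw [ASmat_cons_apply β M i ⟨hk.1, by omega⟩ ⟨hβ₁.1, by omega⟩, if_neg (by omega), add_zero]
  rw [ASmat_cons_apply _ _ _ hj ⟨h₁.1, by dsimp; omega⟩,
    ASmat_cons_apply _ _ _ hj ⟨h₂.1, by dsimp; omega⟩,
    ASmat_cons_apply _ _ _ hj ⟨h₃.1, by dsimp; omega⟩,
    ASmat_of_lt hL i (Nat.lt_succ_self r) hrm, hid]
  simp only [if_true, zero_add]
  rw [hcol _ _ i₂ rfl h₃ h₂, hcol _ _ i₁ rfl h₂ h₁, hcol _ _ i₁ rfl h₃ h₁]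

lemma MinorsNonvanishing.step {r : ℕ} {L : List (ℕ × ℕ)} (hL : PosRoots r L) (hr : 3 ≤ r)
    (h : MinorsNonvanishing r L) {i₁ i₂ i₃ : ℕ}
    (h₁ : 1 ≤ i₁ ∧ i₁ ≤ r) (h₂ : 1 ≤ i₂ ∧ i₂ ≤ r) (h₃ : 1 ≤ i₃ ∧ i₃ ≤ r)
    (h₁₂ : i₁ ≠ i₂) (h₁₃ : i₁ ≠ i₃) (h₂₃ : i₂ ≠ i₃) :
    MinorsNonvanishing (r + 1) ((i₁, r + 1) :: (i₂, r + 1) :: (i₃, r + 1) :: L) := by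
  intro m hm I hI hb
  by_cases hlast : ∃ c, I c = r + 1
  · obtain ⟨c, hc⟩ := hlast
    have hlt : ∀ b, b ≠ c → I b ≤ r := fun b hbc => by
      have := hb b
      have : I b ≠ I c := hI.ne hbc
      omega
    obtain ⟨k, hk, hkI⟩ : ∃ k, (k = i₁ ∨ k = i₂ ∨ k = i₃) ∧ ∀ b, b ≠ c → I b ≠ k := by
      by_contra! hcon
      obtain ⟨b₁, hb₁, e₁⟩ := hcon i₁ (by simp)
      obtain ⟨b₂, hb₂, e₂⟩ := hcon i₂ (by simp)
      obtain ⟨b₃, hb₃, e₃⟩ := hcon i₃ (by simp)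
      have n₁₂ : b₁ ≠ b₂ := by rintro rfl; omega
      have n₁₃ : b₁ ≠ b₃ := by rintro rfl; omega
      have n₂₃ : b₂ ≠ b₃ := by rintro rfl; omega
      omega
    have hkr : 1 ≤ k ∧ k ≤ r := by omega
    have hJinj : Function.Injective (Function.update I c k) := by
      intro a b hab
      by_cases ha : a = c <;> by_cases hb' : b = c
      · rw [ha, hb']
      · subst ha
        simp only [Function.update_self, Function.update_of_ne hb'] at hab
        exact absurd hab.symm (hkI b hb')
      · subst hb'
        simp only [Function.update_self, Function.update_of_ne ha] at hab
        exact absurd hab (hkI a ha)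
      · simp only [Function.update_of_ne ha, Function.update_of_ne hb'] at hab
        exact hI hab
    have hJb : ∀ b, 1 ≤ Function.update I c k b ∧ Function.update I c k b ≤ r := by
      intro b
      by_cases hbc : b = c
      · subst hbc; simpa using hkr
      · rw [Function.update_of_ne hbc]; exact ⟨(hb b).1, hlt b hbc⟩
    obtain ⟨v, hv⟩ := h m (by omega) _ hJinj hJb
    refine ⟨fun β => if β.2 = r + 1 then (if β.1 = k then 1 else 0) else v β, ?_⟩
    set w : ℕ × ℕ → ℂ := fun β => if β.2 = r + 1 then (if β.1 = k then 1 else 0) else v β with hw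
    have hLm : PosRoots m L := hL.mono (by omega)
    have hwv : ∀ i j, 1 ≤ j → j ≤ r → eval w (ASmat m L i j) = eval v (ASmat m L i j) := by
      intro i j hj₁ hj₂
      refine eval_ASmat_congr hLm (fun β hβ => if_neg ?_) i ⟨hj₁, by omega⟩
      have := hL β hβ
      omega
    convert hv using 3
    ext a b
    by_cases hbc : b = c
    · subst hbc
      rw [hc, ASmat_triple_last hL hm h₁ h₂ h₃ (by omega)]
      simp only [map_add, map_mul, eval_X, Function.update_self]
      rw [hwv _ _ h₁.1 h₁.2, hwv _ _ h₂.1 h₂.2, hwv _ _ h₃.1 h₃.2]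
      rcases hk with rfl | rfl | rfl
      · simp [hw, h₁₂.symm, h₁₃.symm]
      · simp [hw, h₁₂, h₂₃.symm]
      · simp [hw, h₁₃, h₂₃]
    · rw [Function.update_of_ne hbc,
        ASmat_triple_of_ne hm h₁ h₂ h₃ _ ⟨(hb b).1, hlt b hbc⟩, hwv _ _ (hb b).1 (hlt b hbc)]
  · push Not at hlast
    have hb' : ∀ b, 1 ≤ I b ∧ I b ≤ r := fun b => by
      have := hb b
      have := hlast b
      omega
    obtain ⟨v, hv⟩ := h m (by omega) I hI hb'
    refine ⟨v, ?_⟩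
    simpa only [ASmat_triple_of_ne hm h₁ h₂ h₃ _ (hb' _)] using hv

lemma PosRoots.step {r : ℕ} {L : List (ℕ × ℕ)} (hL : PosRoots r L) {i₁ i₂ i₃ : ℕ}
    (h₁ : 1 ≤ i₁ ∧ i₁ ≤ r) (h₂ : 1 ≤ i₂ ∧ i₂ ≤ r) (h₃ : 1 ≤ i₃ ∧ i₃ ≤ r) :
    PosRoots (r + 1) ((i₁, r + 1) :: (i₂, r + 1) :: (i₃, r + 1) :: L) := by
  intro β hβ
  simp only [List.mem_cons] at hβ
  rcases hβ with rfl | rfl | rfl | hβ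
  · dsimp; omega
  · dsimp; omega
  · dsimp; omega
  · exact hL.mono (Nat.le_succ r) β hβ

lemma IsIter.posRoots_and_minorsNonvanishing {n : ℕ} {S : List (ℕ × ℕ)} (hS : IsIter n S) :
    PosRoots n S ∧ MinorsNonvanishing n S := by
  induction hS with
  | base L hL =>
    obtain ⟨i₁, i₂, i₃, rfl⟩ : ∃ i₁ i₂ i₃, L = [(i₁, 4), (i₂, 4), (i₃, 4)] := by
      have hlen := hL.length_eq
      match L, hlen with
      | [a, b, c], _ =>
        have hsnd : ∀ β ∈ [a, b, c], β.2 = 4 := by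
          intro β hβ
          have := hL.subset hβ
          simp only [List.mem_cons, List.not_mem_nil, or_false] at this
          rcases this with rfl | rfl | rfl <;> rfl
        refine ⟨a.1, b.1, c.1, ?_⟩
        have ha : a = (a.1, 4) := Prod.ext rfl (hsnd a (by simp))
        have hb : b = (b.1, 4) := Prod.ext rfl (hsnd b (by simp))
        have hc : c = (c.1, 4) := Prod.ext rfl (hsnd c (by simp))
        rw [← ha, ← hb, ← hc]
    have hnd : [(i₁, 4), (i₂, 4), (i₃, 4)].Nodup := hL.nodup_iff.2 (by decide)
    have hmem : ∀ i, (i, 4) ∈ [(i₁, 4), (i₂, 4), (i₃, 4)] → 1 ≤ i ∧ i ≤ 3 := by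
      intro i hi
      have := hL.subset hi
      simp at this
      omega
    have h₁ := hmem i₁ (by simp)
    have h₂ := hmem i₂ (by simp)
    have h₃ := hmem i₃ (by simp)
    simp at hnd
    have hnil : PosRoots 3 [] := by simp [PosRoots]
    exact ⟨hnil.step h₁ h₂ h₃, minorsNonvanishing_nil.step hnil le_rfl h₁ h₂ h₃
      (by tauto) (by tauto) (by tauto)⟩
  | step r L i₁ i₂ i₃ hr _ a₁ b₁ a₂ b₂ a₃ b₃ h₁₂ h₁₃ h₂₃ ih =>
    exact ⟨ih.1.step ⟨a₁, b₁⟩ ⟨a₂, b₂⟩ ⟨a₃, b₃⟩,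
      ih.2.step ih.1 (by omega) ⟨a₁, b₁⟩ ⟨a₂, b₂⟩ ⟨a₃, b₃⟩ h₁₂ h₁₃ h₂₃⟩

lemma phiStar_ne_zero {n : ℕ} {S : List (ℕ × ℕ)} (hS : IsIter n S) {I : Fin 3 → ℕ}
    (hI : Sorted 3 n I) : phiStar n S I ≠ 0 := by
  obtain ⟨v, hv⟩ := hS.posRoots_and_minorsNonvanishing.2 n le_rfl I hI.1.injective hI.2
  intro h0
  apply hv
  have := congrArg (eval v) h0
  rwa [phiStar, RingHom.map_det, map_zero] at this

lemma psi_valS {n : ℕ} {S : List (ℕ × ℕ)} (hS : IsIter n S) {I : Fin 3 → ℕ}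
    (hI : Sorted 3 n I) : Psi (valS n S I) + 6 = I 0 + I 1 + I 2 :=
  psi_of_mem_support hS.posRoots_and_minorsNonvanishing.1 hI.2
    (minSupp_mem_support S (phiStar_ne_zero hS hI))

lemma psi_add (a b : (ℕ × ℕ) →₀ ℕ) : Psi (a + b) = Psi a + Psi b :=
  Finsupp.sum_add_index' (by simp) (by intros; ring)

lemma sorted_three {n : ℕ} {I : Fin 3 → ℕ} (h₀ : 1 ≤ I 0) (h₀₁ : I 0 < I 1) (h₁₂ : I 1 < I 2)
    (h₂ : I 2 ≤ n) : Sorted 3 n I := by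
  refine ⟨Fin.strictMono_iff_lt_succ.2 fun i => ?_, fun a => ?_⟩
  · fin_cases i
    · exact h₀₁
    · exact h₁₂
  · fin_cases a <;> dsimp <;> omega

lemma sorted_insert3 {n : ℕ} {I : Fin 2 → ℕ} {j : ℕ} (hI : Sorted 2 n I)
    (hj : 1 ≤ j ∧ j ≤ n) (hne : ∀ t, I t ≠ j) :
    Sorted 3 n (insert3 I j) ∧
      insert3 I j 0 + insert3 I j 1 + insert3 I j 2 = I 0 + I 1 + j := by
  have h01 : I 0 < I 1 := hI.1 (by decide)
  have b0 := hI.2 0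
  have b1 := hI.2 1
  have n0 := hne 0
  have n1 := hne 1
  rcases lt_or_gt_of_ne n0 with h0 | h0
  · rcases lt_or_gt_of_ne n1 with h1 | h1
    · have hl : List.insertionSort (· ≤ ·) [I 0, I 1, j] = [I 0, I 1, j] := by
        simp [h01.le, h1.le]
      refine ⟨sorted_three ?_ ?_ ?_ ?_, ?_⟩ <;> simp [insert3, hl] <;> omega
    · have hl : List.insertionSort (· ≤ ·) [I 0, I 1, j] = [I 0, j, I 1] := by
        simp [List.orderedInsert, h0.le, h1.not_ge]
      refine ⟨sorted_three ?_ ?_ ?_ ?_, ?_⟩ <;> simp [insert3, hl] <;> omega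
  · have h1 : j < I 1 := by omega
    have hl : List.insertionSort (· ≤ ·) [I 0, I 1, j] = [j, I 0, I 1] := by
      simp [List.orderedInsert, h0.not_ge, h1.not_ge, h01.le]
    refine ⟨sorted_three ?_ ?_ ?_ ?_, ?_⟩ <;> simp [insert3, hl] <;> omega

lemma sorted_erase4 {n : ℕ} {J : Fin 4 → ℕ} (hJ : Sorted 4 n J) (a : Fin 4) :
    Sorted 3 n (erase4 J (J a)) ∧
      erase4 J (J a) 0 + erase4 J (J a) 1 + erase4 J (J a) 2 + J a =
        J 0 + J 1 + J 2 + J 3 := by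
  have h01 : J 0 < J 1 := hJ.1 (by decide)
  have h12 : J 1 < J 2 := hJ.1 (by decide)
  have h23 : J 2 < J 3 := hJ.1 (by decide)
  have b0 := hJ.2 0
  have b3 := hJ.2 3
  have hinj : ∀ a b, J a = J b ↔ a = b := fun a b => hJ.1.injective.eq_iff
  fin_cases a <;> refine ⟨sorted_three ?_ ?_ ?_ ?_, ?_⟩ <;>
    simp [erase4, hinj] <;> omega

/-- For every `j ∈ J ∖ I`,
`Ψ_S(v_S(p̄_{I∪j}) + v_S(p̄_{J∖j})) = i₁ + i₂ + j₁ + j₂ + j₃ + j₄ - 12`. -/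
theorem psi_of_plucker_term (n : ℕ) (hn : 4 ≤ n) (S : List (ℕ × ℕ)) (hS : IsIter n S)
    (I : Fin 2 → ℕ) (J : Fin 4 → ℕ) (hI : Sorted 2 n I) (hJ : Sorted 4 n J)
    (hR : Rrel n I J ≠ 0) :
    ∀ a : Fin 4, (∀ t : Fin 2, I t ≠ J a) →
      Psi (wvec n S I J a) + 12 = I 0 + I 1 + J 0 + J 1 + J 2 + J 3 := by
  intro a ha
  obtain ⟨hs, hsum⟩ := sorted_insert3 hI (hJ.2 a) ha
  obtain ⟨hs', hsum'⟩ := sorted_erase4 hJ a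
  have h := psi_valS hS hs
  have h' := psi_valS hS hs'
  rw [wvec, psi_add]
  omega
end
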